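/- Let 1 ≤ d ≤ m and 1 ≤ r ≤ m+1−d. Then the r-th generalized Hamming weight of the affine square-free code satisfies d_r(C_d^{A,S}(m)) = (q−1)^{d−1} · q^{m−d−r+1} · (q^r − 1). -/

import Mathlib

/-- Square-free exponent vectors of total degree `d` in `m` variables. -/
def Sd (m d : ℕ) : Set (Fin m → ℕ) := {a | (∀ i, a i ≤ 1) ∧ ∑ i, a i = d}

/-- Square-free exponent vectors of total degree at most `d` in `m` variables. -/
def Sle (m d : ℕ) : Set (Fin m → ℕ) := {a | (∀ i, a i ≤ 1) ∧ ∑ i, a i ≤ d}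

/-- Evaluation code over the Cartesian set `X = A 0 × ⋯ × A (m-1)`, spanned by the
evaluations of the monomials `x^a` for `a ∈ S`. -/
noncomputable def evalCodeX {F : Type*} [Field F] {m : ℕ} (A : Fin m → Finset F)
    (S : Set (Fin m → ℕ)) :
    Submodule F ({P : Fin m → F // ∀ i, P i ∈ A i} → F) :=
  Submodule.span F ((fun (a : Fin m → ℕ) (P : {P : Fin m → F // ∀ i, P i ∈ A i}) =>
    ∏ i, P.1 i ^ a i) '' S)

open Classical in
/-- Support of a linear code. -/
noncomputable def codeSupp {F ι : Type*} [Field F] [Fintype ι]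
    (C : Submodule F (ι → F)) : Finset ι :=
  Finset.univ.filter (fun i => ∃ c ∈ C, c i ≠ 0)

/-- The `r`-th generalized Hamming weight of a linear code: the minimum cardinality of the
support of an `r`-dimensional subcode. -/
noncomputable def GHW {F ι : Type*} [Field F] [Fintype ι]
    (C : Submodule F (ι → F)) (r : ℕ) : ℕ :=
  sInf {k | ∃ C' : Submodule F (ι → F),
    C' ≤ C ∧ Module.finrank F C' = r ∧ (codeSupp C').card = k}

/-- Evaluation code: the span of the evaluations of the monomials `x^a`, `a ∈ S`, at the
family of points `pt : Y → F^N`. -/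
noncomputable def evCode {F : Type*} [Field F] {N : ℕ} {Y : Type*} (pt : Y → (Fin N → F))
    (S : Set (Fin N → ℕ)) : Submodule F (Y → F) :=
  Submodule.span F ((fun (a : Fin N → ℕ) (y : Y) => ∏ i, pt y i ^ a i) '' S)

/-- The forward difference in the first variable, between the values `0` and `1`. -/
def headDiff (F : Type*) [Field F] (m : ℕ) :
    ((Fin (m + 1) → F) → F) →ₗ[F] ((Fin m → F) → F) :=
  LinearMap.funLeft F F (Fin.cons (α := fun _ => F) 1) -
    LinearMap.funLeft F F (Fin.cons (α := fun _ => F) 0)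

/-- Restriction to the hyperplane where the first variable vanishes. -/
def headZero (F : Type*) [Field F] (m : ℕ) :
    ((Fin (m + 1) → F) → F) →ₗ[F] ((Fin m → F) → F) :=
  LinearMap.funLeft F F (Fin.cons (α := fun _ => F) 0)

section

variable {F : Type*} [Field F]

lemma headDiff_apply {m : ℕ} (f : (Fin (m + 1) → F) → F) (P : Fin m → F) :
    headDiff F m f P = f (Fin.cons 1 P) - f (Fin.cons 0 P) := rfl

lemma headZero_apply {m : ℕ} (f : (Fin (m + 1) → F) → F) (P : Fin m → F) :
    headZero F m f P = f (Fin.cons 0 P) := rfl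

lemma mem_codeSupp {ι : Type*} [Fintype ι] {C : Submodule F (ι → F)} {i : ι} :
    i ∈ codeSupp C ↔ ∃ c ∈ C, c i ≠ 0 := by
  simp [codeSupp]

lemma tail_mem_Sd {m d : ℕ} {a : Fin (m + 1) → ℕ} (ha : a ∈ Sd (m + 1) d) :
    (fun i : Fin m => a i.succ) ∈ Sd m (d - a 0) := by
  obtain ⟨h1, h2⟩ := ha
  refine ⟨fun i => h1 _, ?_⟩
  rw [Fin.sum_univ_succ] at h2
  exact Nat.eq_sub_of_add_eq' h2

lemma apply_cons_of_mem_evCode {m d : ℕ} {f : (Fin (m + 1) → F) → F}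
    (hf : f ∈ evCode id (Sd (m + 1) d)) (a : F) (P : Fin m → F) :
    f (Fin.cons a P) = a * headDiff F m f P + headZero F m f P := by
  induction hf using Submodule.span_induction with
  | zero => simp
  | add x y _ _ hx hy => simp only [map_add, Pi.add_apply, hx, hy]; ring
  | smul c x _ hx => simp only [map_smul, Pi.smul_apply, smul_eq_mul, hx]; ring
  | mem x hx =>
    obtain ⟨α, hα, rfl⟩ := hx
    have h0 := hα.1 0
    simp only [headDiff_apply, headZero_apply, Fin.prod_univ_succ, id, Fin.cons_zero,
      Fin.cons_succ]
    interval_cases α 0 <;> simp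

lemma headZero_mem_evCode {m d : ℕ} {f : (Fin (m + 1) → F) → F}
    (hf : f ∈ evCode id (Sd (m + 1) d)) : headZero F m f ∈ evCode id (Sd m d) := by
  induction hf using Submodule.span_induction with
  | zero => simp
  | add x y _ _ hx hy => rw [map_add]; exact add_mem hx hy
  | smul c x _ hx => rw [map_smul]; exact Submodule.smul_mem _ _ hx
  | mem x hx =>
    obtain ⟨α, hα, rfl⟩ := hx
    have h0 := hα.1 0
    have ht := tail_mem_Sd hα
    rcases (by omega : α 0 = 0 ∨ α 0 = 1) with h | h
    · rw [h] at ht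
      refine Submodule.subset_span ⟨_, ht, ?_⟩
      ext P
      simp [headZero_apply, Fin.prod_univ_succ, h]
    · convert Submodule.zero_mem _
      ext P
      simp [headZero_apply, Fin.prod_univ_succ, h]

lemma headDiff_mem_evCode {m d : ℕ} {f : (Fin (m + 1) → F) → F}
    (hf : f ∈ evCode id (Sd (m + 1) (d + 1))) : headDiff F m f ∈ evCode id (Sd m d) := by
  induction hf using Submodule.span_induction with
  | zero => simp
  | add x y _ _ hx hy => rw [map_add]; exact add_mem hx hy
  | smul c x _ hx => rw [map_smul]; exact Submodule.smul_mem _ _ hx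
  | mem x hx =>
    obtain ⟨α, hα, rfl⟩ := hx
    have h0 := hα.1 0
    have ht := tail_mem_Sd hα
    rcases (by omega : α 0 = 0 ∨ α 0 = 1) with h | h
    · convert Submodule.zero_mem _
      ext P
      simp [headDiff_apply, Fin.prod_univ_succ, h]
    · rw [h, Nat.add_sub_cancel] at ht
      refine Submodule.subset_span ⟨_, ht, ?_⟩
      ext P
      simp [headDiff_apply, Fin.prod_univ_succ, h]

lemma headDiff_eq_zero_of_mem_evCode {m : ℕ} {f : (Fin (m + 1) → F) → F}
    (hf : f ∈ evCode id (Sd (m + 1) 0)) : headDiff F m f = 0 := by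
  induction hf using Submodule.span_induction with
  | zero => simp
  | add x y _ _ hx hy => rw [map_add, hx, hy, add_zero]
  | smul c x _ hx => rw [map_smul, hx, smul_zero]
  | mem x hx =>
    obtain ⟨α, ⟨-, hα⟩, rfl⟩ := hx
    have h : α 0 = 0 := (Finset.sum_eq_zero_iff.1 hα) 0 (Finset.mem_univ 0)
    ext P
    simp [headDiff_apply, Fin.prod_univ_succ, h]

lemma finrank_evCode_zero_le {m : ℕ} : Module.finrank F (evCode (F := F) id (Sd m 0)) ≤ 1 := by
  have h : Sd m 0 ⊆ {0} := by
    rintro a ⟨-, ha⟩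
    ext i
    simpa using (Finset.sum_eq_zero_iff.1 ha) i (Finset.mem_univ i)
  refine finrank_le_one (⟨fun _ => 1, ?_⟩ : evCode (F := F) id (Sd m 0)) ?_
  · refine Submodule.subset_span ⟨0, ⟨by simp, by simp⟩, by ext; simp⟩
  · rintro ⟨f, hf⟩
    have : f ∈ Submodule.span F {(fun _ => 1 : (Fin m → F) → F)} := by
      refine Submodule.span_mono ?_ hf
      rintro _ ⟨a, ha, rfl⟩
      rw [h ha]
      simp
    obtain ⟨c, hc⟩ := Submodule.mem_span_singleton.1 this
    exact ⟨c, Subtype.ext hc⟩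

end

lemma Submodule.finrank_map_add_finrank_map_inf_ker {K V W U : Type*} [Field K]
    [AddCommGroup V] [Module K V] [AddCommGroup W] [Module K W] [AddCommGroup U] [Module K U]
    [FiniteDimensional K V] (D : V →ₗ[K] W) (E : V →ₗ[K] U) (p : Submodule K V)
    (h : ∀ v ∈ p, D v = 0 → E v = 0 → v = 0) :
    Module.finrank K (p.map D) + Module.finrank K ((p ⊓ LinearMap.ker D).map E) =
      Module.finrank K p := by
  have h1 := (D.domRestrict p).finrank_range_add_finrank_ker
  have h2 := (E.domRestrict (p ⊓ LinearMap.ker D)).finrank_range_add_finrank_ker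
  have h3 : LinearMap.ker (E.domRestrict (p ⊓ LinearMap.ker D)) = ⊥ := by
    rw [LinearMap.ker_eq_bot']
    rintro ⟨v, hv, hv'⟩ hE
    exact Subtype.ext (h v hv hv' hE)
  have h4 : Module.finrank K (LinearMap.ker (D.domRestrict p)) =
      Module.finrank K (p ⊓ LinearMap.ker D : Submodule K V) := by
    rw [LinearMap.ker_domRestrict, ← Submodule.map_comap_subtype]
    exact (LinearEquiv.finrank_eq (Submodule.equivMapOfInjective _ p.injective_subtype _))
  rw [h3, finrank_bot, add_zero, LinearMap.range_domRestrict] at h2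
  rw [LinearMap.range_domRestrict, h4] at h1
  rw [h2, h1]

section

variable {F : Type*} [Field F] [Fintype F]

open Classical in
lemma card_codeSupp_eq_sum_cons {m : ℕ} (V : Submodule F ((Fin (m + 1) → F) → F)) :
    (codeSupp V).card =
      ∑ P : Fin m → F, (Finset.univ.filter fun a : F => Fin.cons a P ∈ codeSupp V).card := by
  simp only [Finset.card_filter]
  rw [← Fintype.sum_prod_type_right (f := fun x : F × (Fin m → F) =>
      if (Fin.cons x.1 x.2 : Fin (m + 1) → F) ∈ codeSupp V then 1 else 0)]
  refine Eq.trans ?_ (Fintype.sum_equiv (Fin.consEquiv fun _ : Fin (m + 1) => F) _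
    (fun Q => if Q ∈ codeSupp V then 1 else 0) (fun x => rfl)).symm
  simp

lemma cons_mem_codeSupp_of_mem_headZero {m d : ℕ} {V : Submodule F ((Fin (m + 1) → F) → F)}
    (hV : V ≤ evCode id (Sd (m + 1) d)) {P : Fin m → F}
    (hP : P ∈ codeSupp ((V ⊓ LinearMap.ker (headDiff F m)).map (headZero F m))) (a : F) :
    Fin.cons a P ∈ codeSupp V := by
  obtain ⟨_, ⟨f, ⟨hf, hf'⟩, rfl⟩, hne⟩ := mem_codeSupp.1 hP
  refine mem_codeSupp.2 ⟨f, hf, ?_⟩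
  rw [apply_cons_of_mem_evCode (hV hf), LinearMap.mem_ker.1 hf']
  simpa using hne

open Classical in
lemma card_le_card_filter_cons_mem_codeSupp {m d : ℕ}
    {V : Submodule F ((Fin (m + 1) → F) → F)} (hV : V ≤ evCode id (Sd (m + 1) d))
    {P : Fin m → F} (hP : P ∈ codeSupp (V.map (headDiff F m))) :
    Fintype.card F - 1 ≤
      (Finset.univ.filter fun a : F => Fin.cons a P ∈ codeSupp V).card := by
  obtain ⟨_, ⟨f, hf, rfl⟩, hne⟩ := mem_codeSupp.1 hP
  set b : F := -(headZero F m f P) / headDiff F m f P with hb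
  rw [← Finset.card_univ, ← Finset.card_erase_of_mem (Finset.mem_univ b)]
  refine Finset.card_le_card fun a ha => ?_
  rw [Finset.mem_filter]
  refine ⟨Finset.mem_univ _, mem_codeSupp.2 ⟨f, hf, fun h0 => Finset.ne_of_mem_erase ha ?_⟩⟩
  rw [apply_cons_of_mem_evCode (hV hf)] at h0
  rw [hb, eq_div_iff hne]
  exact eq_neg_of_add_eq_zero_left h0

lemma card_mul_card_codeSupp_headZero_le {m d : ℕ}
    {V : Submodule F ((Fin (m + 1) → F) → F)} (hV : V ≤ evCode id (Sd (m + 1) d)) :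
    Fintype.card F *
      (codeSupp ((V ⊓ LinearMap.ker (headDiff F m)).map (headZero F m))).card ≤
      (codeSupp V).card := by
  classical
  rw [card_codeSupp_eq_sum_cons, mul_comm, ← smul_eq_mul, ← Finset.sum_const]
  refine (Finset.sum_le_sum fun P hP => ?_).trans
    (Finset.sum_le_sum_of_subset (Finset.subset_univ _))
  rw [Finset.filter_true_of_mem fun a _ => cons_mem_codeSupp_of_mem_headZero hV hP a,
    Finset.card_univ]

lemma card_codeSupp_headDiff_add_le {m d : ℕ}
    {V : Submodule F ((Fin (m + 1) → F) → F)} (hV : V ≤ evCode id (Sd (m + 1) d)) :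
    (Fintype.card F - 1) * (codeSupp (V.map (headDiff F m))).card +
      (codeSupp ((V ⊓ LinearMap.ker (headDiff F m)).map (headZero F m))).card ≤
      (codeSupp V).card := by
  classical
  set G := codeSupp (V.map (headDiff F m)) with hG
  set K := codeSupp ((V ⊓ LinearMap.ker (headDiff F m)).map (headZero F m)) with hK
  have h1 : (Fintype.card F - 1) * G.card + K.card =
      ∑ P : Fin m → F, ((if P ∈ G then Fintype.card F - 1 else 0) +
        if P ∈ K then 1 else 0) := by
    simp [Finset.sum_add_distrib, Finset.sum_ite_mem, mul_comm]
  rw [card_codeSupp_eq_sum_cons, h1]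
  refine Finset.sum_le_sum fun P _ => ?_
  have hq : 0 < Fintype.card F := Fintype.card_pos
  by_cases hPK : P ∈ K
  · rw [Finset.filter_true_of_mem fun a _ => cons_mem_codeSupp_of_mem_headZero hV hPK a,
      Finset.card_univ, if_pos hPK]
    split_ifs <;> omega
  · rw [if_neg hPK, add_zero]
    split_ifs with hPG
    · exact card_le_card_filter_cons_mem_codeSupp hV hPG
    · exact Nat.zero_le _

/-- The bound on supports, valid for every dimension and every degree (including `0`). -/
lemma le_card_codeSupp_mul {m d : ℕ} {V : Submodule F ((Fin m → F) → F)}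
    (hV : V ≤ evCode id (Sd m d)) :
    (Fintype.card F : ℚ) ^ m * (1 - (Fintype.card F : ℚ)⁻¹) ^ d *
      (1 - (Fintype.card F : ℚ)⁻¹ ^ Module.finrank F V) ≤
      (codeSupp V).card * (1 - (Fintype.card F : ℚ)⁻¹) := by
  have hq : (1 : ℚ) < Fintype.card F := by exact_mod_cast Fintype.one_lt_card
  set q : ℚ := (Fintype.card F : ℚ) with hqdef
  set s := q⁻¹ with hs
  have hqs : q * s = 1 := mul_inv_cancel₀ (by positivity)
  have hs0 : 0 < s := by positivity
  have hs1 : s < 1 := inv_lt_one_of_one_lt₀ hq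
  induction m generalizing d with
  | zero =>
    have hle := Submodule.finrank_mono hV
    rcases Nat.eq_zero_or_pos d with rfl | hd
    · have hle' := hle.trans finrank_evCode_zero_le
      rcases (by omega : Module.finrank F V = 0 ∨ Module.finrank F V = 1) with h | h
      · rw [h, pow_zero s, sub_self, mul_zero]
        exact mul_nonneg (Nat.cast_nonneg _) (by linarith)
      · have : 0 < (codeSupp V).card := by
          have hne : V ≠ ⊥ := by rintro rfl; simp at h
          obtain ⟨f, hf, hf0⟩ := Submodule.exists_mem_ne_zero_of_ne_bot hne
          obtain ⟨P, hP⟩ := Function.ne_iff.1 hf0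
          exact Finset.card_pos.2 ⟨P, mem_codeSupp.2 ⟨f, hf, hP⟩⟩
        have : (1 : ℚ) ≤ (codeSupp V).card := by exact_mod_cast this
        rw [h]
        nlinarith
    · have hS : Sd 0 d = ∅ := by
        ext a
        simp [Sd, hd.ne]
      have h : Module.finrank F V = 0 := by simpa [evCode, hS] using hV
      rw [h, pow_zero s, sub_self, mul_zero]
      exact mul_nonneg (Nat.cast_nonneg _) (by linarith)
  | succ m ih =>
    have hdim := Submodule.finrank_map_add_finrank_map_inf_ker (headDiff F m) (headZero F m) V
      fun f hf h1 h2 => by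
        ext P
        rw [← Fin.cons_self_tail P, apply_cons_of_mem_evCode (hV hf), h1, h2]
        simp
    have hKle : (V ⊓ LinearMap.ker (headDiff F m)).map (headZero F m) ≤ evCode id (Sd m d) := by
      rintro _ ⟨f, ⟨hf, -⟩, rfl⟩
      exact headZero_mem_evCode (hV hf)
    have hK := ih hKle
    have hKpos := card_mul_card_codeSupp_headZero_le hV
    have hsum := card_codeSupp_headDiff_add_le hV
    set NK := (codeSupp ((V ⊓ LinearMap.ker (headDiff F m)).map (headZero F m))).card
    set k := Module.finrank F ((V ⊓ LinearMap.ker (headDiff F m)).map (headZero F m))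
    by_cases hg : Module.finrank F (V.map (headDiff F m)) = 0
    · rw [hg, zero_add] at hdim
      rw [← hdim]
      have hc : q * NK ≤ (codeSupp V).card := by rw [hqdef]; exact_mod_cast hKpos
      calc q ^ (m + 1) * (1 - s) ^ d * (1 - s ^ k)
          = q * (q ^ m * (1 - s) ^ d * (1 - s ^ k)) := by ring
        _ ≤ q * (NK * (1 - s)) := by gcongr
        _ = q * NK * (1 - s) := by ring
        _ ≤ _ := mul_le_mul_of_nonneg_right hc (by linarith)
    · obtain ⟨e, rfl⟩ : ∃ e, d = e + 1 := by
        refine Nat.exists_eq_succ_of_ne_zero ?_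
        rintro rfl
        refine hg ?_
        have : V.map (headDiff F m) = ⊥ := by
          rw [eq_bot_iff]
          rintro _ ⟨f, hf, rfl⟩
          exact headDiff_eq_zero_of_mem_evCode (hV hf)
        rw [this, finrank_bot]
      have hG := ih (V := V.map (headDiff F m)) (d := e) (by
        rintro _ ⟨f, hf, rfl⟩
        exact headDiff_mem_evCode (hV hf))
      set NG := (codeSupp (V.map (headDiff F m))).card
      obtain ⟨g, hg'⟩ := Nat.exists_eq_succ_of_ne_zero hg
      rw [hg'] at hG hdim
      rw [← hdim]
      have hc : (q - 1) * NG + NK ≤ (codeSupp V).card := by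
        have : ((Fintype.card F - 1 : ℕ) : ℚ) = q - 1 := by
          rw [Nat.cast_sub Fintype.card_pos, Nat.cast_one]
        rw [← this]
        exact_mod_cast hsum
      have hsk : 0 ≤ 1 - s ^ k := by linarith [pow_le_one₀ (n := k) hs0.le hs1.le]
      have hsg : 0 ≤ 1 - s ^ g := by linarith [pow_le_one₀ (n := g) hs0.le hs1.le]
      have hs' : 0 ≤ 1 - s := by linarith
      have hq1 : q - 1 = q * (1 - s) := by linear_combination hqs
      calc q ^ (m + 1) * (1 - s) ^ (e + 1) * (1 - s ^ (g + 1 + k))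
          ≤ q ^ (m + 1) * (1 - s) ^ (e + 1) *
              (1 - s ^ (g + 1 + k) + s * ((1 - s ^ g) * (1 - s ^ k))) := by
            have := mul_nonneg hs0.le (mul_nonneg hsg hsk)
            gcongr
            linarith
        _ = (q - 1) * (q ^ m * (1 - s) ^ e * (1 - s ^ (g + 1))) +
              q ^ m * (1 - s) ^ (e + 1) * (1 - s ^ k) := by
            rw [hq1]
            linear_combination q ^ m * (1 - s) ^ (e + 1) * (1 - s ^ k) * hqs
        _ ≤ (q - 1) * (NG * (1 - s)) + NK * (1 - s) := by
            have : 0 ≤ q - 1 := by linarith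
            gcongr
        _ = ((q - 1) * NG + NK) * (1 - s) := by ring
        _ ≤ _ := mul_le_mul_of_nonneg_right hc hs'

end

lemma prod_pow_append_one_single {F : Type*} [Field F] {t r e : ℕ} (i : Fin r)
    (P : Fin (t + (r + e)) → F) :
    ∏ j, P j ^ (Fin.append (fun _ => 1) (Fin.append (Pi.single i 1) (fun _ => 0)) :
      Fin (t + (r + e)) → ℕ) j =
      (∏ j, P (Fin.castAdd _ j)) * P (Fin.natAdd t (Fin.castAdd e i)) := by
  simp [Fin.prod_univ_add, Pi.single_apply, pow_ite]

lemma append_one_single_mem_Sd {t r e : ℕ} (i : Fin r) :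
    (Fin.append (fun _ => 1) (Fin.append (Pi.single i 1) (fun _ => 0)) :
      Fin (t + (r + e)) → ℕ) ∈ Sd (t + (r + e)) (t + 1) := by
  constructor
  · refine Fin.addCases (fun j => ?_) (fun j => Fin.addCases (fun k => ?_) (fun k => ?_) j)
    · simp
    · simp only [Fin.append_right, Fin.append_left, Pi.single_apply]
      split_ifs <;> simp
    · simp
  · simp [Fin.sum_univ_add]

section

variable {F : Type*} [Field F] [Fintype F] [DecidableEq F]

lemma card_codeSupp_lower_bound {t r e : ℕ}
    {C : Submodule F ({v : Fin (t + (r + e)) → F // v ≠ 0} → F)}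
    (hC : C ≤ evCode Subtype.val (Sd (t + (r + e)) (t + 1))) (hr : Module.finrank F C = r) :
    (Fintype.card F - 1) ^ t * Fintype.card F ^ e * (Fintype.card F ^ r - 1) ≤
      (codeSupp C).card := by
  set ext := Function.ExtendByZero.linearMap F
    (Subtype.val : {v : Fin (t + (r + e)) → F // v ≠ 0} → (Fin (t + (r + e)) → F))
  have hinj : Function.Injective ext := 
    Function.extend_injective Subtype.val_injective (0 : (Fin (t + (r + e)) → F) → F)
  have happ : ∀ f (v : {v : Fin (t + (r + e)) → F // v ≠ 0}), ext f v.1 = f v := fun f v =>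
    Subtype.val_injective.extend_apply f 0 v
  have happ0 : ∀ f, ext f 0 = 0 := fun f =>
    Function.extend_apply' f (0 : (Fin (t + (r + e)) → F) → F) 0 (fun ⟨v, hv⟩ => v.2 hv)
  have hle : C.map ext ≤ evCode id (Sd (t + (r + e)) (t + 1)) := by
    refine (Submodule.map_mono hC).trans ?_
    rw [evCode, Submodule.map_span, Submodule.span_le]
    rintro _ ⟨_, ⟨a, ha, rfl⟩, rfl⟩
    refine Submodule.subset_span ⟨a, ha, ?_⟩
    ext P
    by_cases hP : P = 0
    · subst hP
      obtain ⟨i, -, hi⟩ := Finset.exists_ne_zero_of_sum_ne_zero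
        (show ∑ i, a i ≠ 0 by rw [ha.2]; omega)
      rw [happ0]
      exact Finset.prod_eq_zero (Finset.mem_univ i) (by simp [hi])
    · rw [happ _ ⟨P, hP⟩]
      rfl
  have hcard : (codeSupp (C.map ext)).card ≤ (codeSupp C).card := by
    rw [← Finset.card_map (Function.Embedding.subtype _)]
    refine Finset.card_le_card fun P hP => ?_
    obtain ⟨_, ⟨f, hf, rfl⟩, hne⟩ := mem_codeSupp.1 hP
    have hP0 : P ≠ 0 := by rintro rfl; exact hne (happ0 f)
    rw [Finset.mem_map]
    exact ⟨⟨P, hP0⟩, mem_codeSupp.2 ⟨f, hf, (happ f ⟨P, hP0⟩) ▸ hne⟩, rfl⟩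
  have hfin : Module.finrank F (C.map ext) = r := 
    (Submodule.equivMapOfInjective _ hinj C).finrank_eq.symm.trans hr
  have key := le_card_codeSupp_mul hle
  rw [hfin] at key
  refine le_trans ?_ hcard
  have hq : (1 : ℚ) < Fintype.card F := by exact_mod_cast Fintype.one_lt_card
  have hpow : 1 ≤ Fintype.card F ^ r := Nat.one_le_pow _ _ Fintype.card_pos
  rw [← Nat.cast_le (α := ℚ)]
  push_cast [Nat.cast_sub hpow, Nat.cast_sub (Fintype.card_pos (α := F))]
  have hp : (0 : ℚ) < 1 - (Fintype.card F : ℚ)⁻¹ := by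
    linarith [inv_lt_one_of_one_lt₀ hq]
  refine le_of_mul_le_mul_right (le_trans (le_of_eq ?_) key) hp
  set q : ℚ := (Fintype.card F : ℚ)
  have hq0 : q ≠ 0 := by positivity
  have h1 : q - 1 = q * (1 - q⁻¹) := by field_simp
  have h2 : q ^ r - 1 = q ^ r * (1 - q⁻¹ ^ r) := by
    rw [inv_pow, mul_sub, mul_inv_cancel₀ (pow_ne_zero r hq0), mul_one]
  rw [h1, h2]
  generalize 1 - q⁻¹ = p
  ring

lemma exists_le_evCode_card_codeSupp_le (t r e : ℕ) :
    ∃ C : Submodule F ({v : Fin (t + (r + e)) → F // v ≠ 0} → F),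
      C ≤ evCode Subtype.val (Sd (t + (r + e)) (t + 1)) ∧ Module.finrank F C = r ∧
      (codeSupp C).card ≤
        (Fintype.card F - 1) ^ t * Fintype.card F ^ e * (Fintype.card F ^ r - 1) := by
  set φ : Fin r → {v : Fin (t + (r + e)) → F // v ≠ 0} → F := fun i P =>
    (∏ j, P.1 (Fin.castAdd _ j)) * P.1 (Fin.natAdd t (Fin.castAdd e i)) with hφ
  refine ⟨Submodule.span F (Set.range φ), ?_, ?_, ?_⟩
  · rw [Submodule.span_le]
    rintro _ ⟨i, rfl⟩
    refine Submodule.subset_span ⟨_, append_one_single_mem_Sd i, ?_⟩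
    ext P
    exact prod_pow_append_one_single i P.1
  · rw [finrank_span_eq_card, Fintype.card_fin]
    rw [Fintype.linearIndependent_iff]
    intro c hc i
    have hne : (Fin.append (fun _ => 1) (Fin.append (Pi.single i 1) (fun _ => 0)) :
        Fin (t + (r + e)) → F) ≠ 0 := fun h => by
      simpa using congrFun h (Fin.natAdd t (Fin.castAdd e i))
    have := congrFun hc ⟨_, hne⟩
    simpa [hφ, Finset.sum_apply, Pi.single_apply] using this
  · set A : Finset (Fin (t + (r + e)) → F) := Fintype.piFinset
      (Fin.append (fun _ => Finset.univ.erase 0)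
        (Fin.append (fun _ => Finset.univ) (fun _ => Finset.univ))) with hA
    set B : Finset (Fin (t + (r + e)) → F) := Fintype.piFinset
      (Fin.append (fun _ => Finset.univ.erase 0)
        (Fin.append (fun _ => {0}) (fun _ => Finset.univ))) with hB
    have hAcard : A.card =
        (Fintype.card F - 1) ^ t * (Fintype.card F ^ r * Fintype.card F ^ e) := by
      simp [hA, Fintype.card_piFinset, Fin.prod_univ_add, Finset.card_erase_of_mem]
    have hBcard : B.card = (Fintype.card F - 1) ^ t * Fintype.card F ^ e := by
      simp [hB, Fintype.card_piFinset, Fin.prod_univ_add, Finset.card_erase_of_mem]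
    have hmemA : ∀ P, P ∈ A ↔ ∀ j : Fin t, P (Fin.castAdd _ j) ≠ 0 := fun P => by
      simp [hA, Fintype.mem_piFinset, Fin.forall_fin_add]
    have hmemB : ∀ P, P ∈ B ↔ (∀ j : Fin t, P (Fin.castAdd _ j) ≠ 0) ∧
        ∀ i : Fin r, P (Fin.natAdd t (Fin.castAdd e i)) = 0 := fun P => by
      simp [hB, Fintype.mem_piFinset, Fin.forall_fin_add]
    clear_value A B
    have hBA : B ⊆ A := fun P hP => (hmemA P).2 ((hmemB P).1 hP).1
    have hsupp : ∀ P ∈ codeSupp (Submodule.span F (Set.range φ)), P.1 ∈ A \ B := by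
      intro P hP
      obtain ⟨f, hf, hne⟩ := mem_codeSupp.1 hP
      obtain ⟨i, hi⟩ : ∃ i, φ i P ≠ 0 := by
        by_contra! h
        refine hne ?_
        have : Submodule.span F (Set.range φ) ≤ LinearMap.ker (LinearMap.proj P) := by
          rw [Submodule.span_le]
          rintro _ ⟨i, rfl⟩
          exact LinearMap.mem_ker.2 (h i)
        exact LinearMap.mem_ker.1 (this hf)
      simp only [hφ] at hi
      have h1 := left_ne_zero_of_mul hi
      have h2 := right_ne_zero_of_mul hi
      rw [Finset.prod_ne_zero_iff] at h1
      rw [Finset.mem_sdiff, hmemA, hmemB]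
      exact ⟨fun j => h1 j (Finset.mem_univ j), fun h => h2 (h.2 i)⟩
    calc (codeSupp (Submodule.span F (Set.range φ))).card
        ≤ (A \ B).card :=
          Finset.card_le_card_of_injOn Subtype.val hsupp Subtype.val_injective.injOn
      _ = _ := by
          rw [Finset.card_sdiff_of_subset hBA, hAcard, hBcard, Nat.mul_sub, mul_one]
          congr 1
          ring

end

/-- Let `1 ≤ d ≤ m` and `1 ≤ r ≤ m+1−d`. The `r`-th generalized Hamming
weight of the affine square-free code `C_d^{A,S}(m)` (evaluation of the square-free
monomials of degree `d` at all points of `F_q^m ∖ {0}`) is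
`(q−1)^{d−1} · q^{m−d−r+1} · (q^r − 1)`. -/
theorem ghw_affine_squarefree_formula
    {F : Type*} [Field F] [Fintype F] [DecidableEq F] {m d r : ℕ}
    (hd1 : 1 ≤ d) (hdm : d ≤ m) (hr1 : 1 ≤ r) (hr2 : r ≤ m + 1 - d) :
    GHW (evCode (Subtype.val : {v : Fin m → F // v ≠ 0} → (Fin m → F)) (Sd m d)) r =
      (Fintype.card F - 1) ^ (d - 1) * Fintype.card F ^ (m + 1 - d - r) *
        (Fintype.card F ^ r - 1) := by
  obtain ⟨t, rfl⟩ : ∃ t, d = t + 1 := ⟨d - 1, by omega⟩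
  obtain ⟨e, rfl⟩ : ∃ e, m = t + (r + e) := ⟨m - t - r, by omega⟩
  rw [show t + (r + e) + 1 - (t + 1) - r = e by omega, Nat.add_sub_cancel]
  obtain ⟨C, hC, hr, hcard⟩ := exists_le_evCode_card_codeSupp_le (F := F) t r e
  unfold GHW
  refine le_antisymm ((Nat.sInf_le ?_).trans hcard) (le_csInf ?_ ?_)
  · exact ⟨C, hC, hr, rfl⟩
  · exact ⟨_, C, hC, hr, rfl⟩
  rintro _ ⟨C', hC', hr', rfl⟩
  exact card_codeSupp_lower_bound hC' hr'
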